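/- arXiv:1509.03748 — 2 statements merged into one kernel-verified Lean document; each statement's English description precedes it below -/
import Mathlib

section
/- Let X be a proper metric space and γ a constant-speed bicombing on X. Then FS(X,γ), equipped with the restriction of the metric D on Lip₁(X), is a proper metric space. -/
open MeasureTheory Set

namespace FJ

/-- A constant-speed bicombing on a metric space `X`: a continuous map
`γ : X × X × [0,1] → X` such that each `γ_{x,y} := γ(x,y,·)` is a rectifiable path from `x`
to `y` of constant speed equal to its length `len x y`. -/
structure ConstSpeedBicombing (X : Type*) [MetricSpace X] where
  toFun : X → X → ℝ → X
  len : X → X → ℝ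
  len_nonneg : ∀ x y, 0 ≤ len x y
  continuousOn : ContinuousOn (fun p : X × X × ℝ => toFun p.1 p.2.1 p.2.2)
      (Set.univ ×ˢ Set.univ ×ˢ Set.Icc (0:ℝ) 1)
  source : ∀ x y, toFun x y 0 = x
  target : ∀ x y, toFun x y 1 = y
  speed : ∀ (x y : X) (s t : ℝ), 0 ≤ s → s ≤ t → t ≤ 1 →
      eVariationOn (toFun x y) (Set.Icc s t) = ENNReal.ofReal (len x y * (t - s))

/-- The trail `c_{x,y} : ℝ → X` associated to a bicombing: constant `x` on `(-∞,0]`,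
the path `γ_{x,y}` parametrised by arclength on `[0, len x y]`, constant `y` on
`[len x y, ∞)`. -/
noncomputable def trail {X : Type*} [MetricSpace X] (B : ConstSpeedBicombing X)
    (x y : X) : ℝ → X :=
  fun t => if t ≤ 0 then x else if t < B.len x y then B.toFun x y (t / B.len x y) else y

/-- The shift `Φ_τ(f) = f(· + τ)`. -/
def timeShift {X : Type*} (τ : ℝ) (f : ℝ → X) : ℝ → X := fun t => f (t + τ)

/-- The metric `D` on `Lip₁(X)`: `D(f,g) = ∫_ℝ d(f t, g t) / (2 e^{|t|}) dt`. -/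
noncomputable def lipDist {X : Type*} [MetricSpace X] (f g : ℝ → X) : ℝ :=
  ∫ t : ℝ, dist (f t) (g t) / (2 * Real.exp |t|)

/-- `A(X,γ) = {Φ_τ c_{x,y} | τ ∈ ℝ, x, y ∈ X}`, as a subset of `C(ℝ, X)` (whose
compact-open topology induces on `Lip₁(X)` the topology of the metric `D`). -/
def ASet {X : Type*} [MetricSpace X] (B : ConstSpeedBicombing X) : Set C(ℝ, X) :=
  {w | ∃ (x y : X) (τ : ℝ), ∀ s, w s = trail B x y (s + τ)}

/-- The flow space `FS(X,γ)`, the closure of `A(X,γ)`. -/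
def FSSet {X : Type*} [MetricSpace X] (B : ConstSpeedBicombing X) : Set C(ℝ, X) :=
  closure (ASet B)

/-- The restriction `res_{[a,b]}(w)`: equal to `w a` on `(-∞,a]`, to `w` on `[a,b]`,
and to `w b` on `[b,∞)`. -/
noncomputable def trailRes {X : Type*} (a b : ℝ) (w : ℝ → X) : ℝ → X :=
  fun t => if t ≤ a then w a else if t ≤ b then w t else w b

/-- `A(X,γ,[a,b]) = A(X,γ) ∩ Lip₁(X,[a,b])`: the elements of `A(X,γ)` which are constant
on `(-∞,a]` and on `[b,∞)`. -/
def AIntSet {X : Type*} [MetricSpace X] (B : ConstSpeedBicombing X) (a b : ℝ) :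
    Set C(ℝ, X) :=
  {w | w ∈ ASet B ∧ (∀ s, s ≤ a → w s = w a) ∧ (∀ s, b ≤ s → w s = w b)}

/-- A bicombing is consistent if the chosen paths behave well under restriction. -/
def BicombingConsistent {X : Type*} [MetricSpace X] (B : ConstSpeedBicombing X) : Prop :=
  ∀ (x y : X) (s s' t : ℝ), 0 ≤ s → s < s' → s' ≤ 1 → s ≤ t → t ≤ s' →
    B.toFun x y t = B.toFun (B.toFun x y s) (B.toFun x y s') ((t - s) / (s' - s))

/-- A bicombing is `A`-convex if `d(γ_{x,y}(t), γ_{x',y'}(t)) ≤ A(t, d(x,x'), d(y,y'))`. -/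
def BicombingAConvex {X : Type*} [MetricSpace X] (B : ConstSpeedBicombing X)
    (A : ℝ → ℝ → ℝ → ℝ) : Prop :=
  ∀ (x x' y y' : X) (t : ℝ), 0 ≤ t → t ≤ 1 →
    dist (B.toFun x y t) (B.toFun x' y' t) ≤ A t (dist x x') (dist y y')

/-- The conditions on the comparison function `A` of an `A`-convex bicombing:
`A : [0,1] × [0,∞) × [0,∞) → [0,∞)` is continuous with `A(1,s,0) = A(0,0,s) = 0`. -/
def ConvexityFun (A : ℝ → ℝ → ℝ → ℝ) : Prop :=
  ContinuousOn (fun p : ℝ × ℝ × ℝ => A p.1 p.2.1 p.2.2)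
      (Set.Icc (0:ℝ) 1 ×ˢ Set.Ici (0:ℝ) ×ˢ Set.Ici (0:ℝ)) ∧
  (∀ t s s', 0 ≤ t → t ≤ 1 → 0 ≤ s → 0 ≤ s' → 0 ≤ A t s s') ∧
  (∀ s, 0 ≤ s → A 1 s 0 = 0) ∧ (∀ s, 0 ≤ s → A 0 0 s = 0)

/-- The monotonicity conditions on `A`: monotonically increasing in the second and third
arguments and, in the first argument, monotonically increasing on `[0,1/3]` and
monotonically decreasing on `[2/3,1]`. -/
def MonotoneConvexityFun (A : ℝ → ℝ → ℝ → ℝ) : Prop :=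
  (∀ t s₁ s₂ s', 0 ≤ t → t ≤ 1 → 0 ≤ s₁ → s₁ ≤ s₂ → 0 ≤ s' → A t s₁ s' ≤ A t s₂ s') ∧
  (∀ t s s₁ s₂, 0 ≤ t → t ≤ 1 → 0 ≤ s → 0 ≤ s₁ → s₁ ≤ s₂ → A t s s₁ ≤ A t s s₂) ∧
  (∀ t₁ t₂ s s', 0 ≤ t₁ → t₁ ≤ t₂ → t₂ ≤ 1/3 → 0 ≤ s → 0 ≤ s' → A t₁ s s' ≤ A t₂ s s') ∧
  (∀ t₁ t₂ s s', 2/3 ≤ t₁ → t₁ ≤ t₂ → t₂ ≤ 1 → 0 ≤ s → 0 ≤ s' → A t₂ s s' ≤ A t₁ s s')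

section Auxiliary

variable {X : Type*} [MetricSpace X]

lemma dist_toFun_le (B : ConstSpeedBicombing X) (x y : X) {s t : ℝ} (hs : 0 ≤ s) (hst : s ≤ t)
    (ht : t ≤ 1) : dist (B.toFun x y s) (B.toFun x y t) ≤ B.len x y * (t - s) := by
  have h := eVariationOn.edist_le (B.toFun x y) (left_mem_Icc.2 hst) (right_mem_Icc.2 hst)
  rw [B.speed x y s t hs hst ht, edist_dist] at h
  exact (ENNReal.ofReal_le_ofReal_iff
    (mul_nonneg (B.len_nonneg x y) (sub_nonneg.2 hst))).1 h

lemma trail_eq_toFun_clamp (B : ConstSpeedBicombing X) (x y : X) (t : ℝ) :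
    trail B x y t = B.toFun x y (max 0 (min 1 (t / B.len x y))) := by
  unfold trail
  split_ifs with h0 h1
  · have : t / B.len x y ≤ 0 := div_nonpos_of_nonpos_of_nonneg h0 (B.len_nonneg x y)
    rw [min_eq_right (this.trans zero_le_one), max_eq_left this, B.source]
  · have hpos : 0 < B.len x y := (not_le.1 h0).trans h1
    rw [min_eq_right ((div_le_one hpos).2 h1.le), max_eq_right]
    exact div_nonneg (not_le.1 h0).le hpos.le
  · rcases (B.len_nonneg x y).eq_or_lt with hl | hl
    · have h := dist_toFun_le B x y le_rfl zero_le_one le_rfl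
      rw [B.source, B.target, ← hl, zero_mul] at h
      rw [← hl, div_zero, min_eq_right zero_le_one, max_self, B.source, dist_le_zero.1 h]
    · rw [min_eq_left ((one_le_div hl).2 (not_lt.1 h1)), max_eq_right zero_le_one, B.target]

lemma lipschitzWith_trail (B : ConstSpeedBicombing X) (x y : X) :
    LipschitzWith 1 (trail B x y) := by
  refine LipschitzWith.of_dist_le_mul fun s t => ?_
  wlog hst : s ≤ t generalizing s t
  · simpa only [dist_comm] using this t s (le_of_not_ge hst)
  have hL := B.len_nonneg x y
  have hdiv : s / B.len x y ≤ t / B.len x y := by gcongr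
  have hclamp : max 0 (min 1 (t / B.len x y)) - max 0 (min 1 (s / B.len x y)) ≤
      t / B.len x y - s / B.len x y := by
    grind
  rw [trail_eq_toFun_clamp, trail_eq_toFun_clamp, NNReal.coe_one, one_mul, dist_comm s t,
    Real.dist_eq, abs_of_nonneg (sub_nonneg.2 hst)]
  refine (dist_toFun_le B x y (le_max_left _ _) (by gcongr)
    (max_le zero_le_one (min_le_left _ _))).trans ?_
  refine (mul_le_mul_of_nonneg_left hclamp hL).trans ?_
  rcases hL.eq_or_lt with hl | hl
  · simpa [← hl] using hst
  · exact le_of_eq (by field_simp)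

lemma isClosed_setOf_lipschitzWith_one :
    IsClosed {w : C(ℝ, X) | LipschitzWith 1 w} :=
  (isClosed_setOfPred_lipschitzWith 1).preimage continuous_coeFun

lemma lipschitzWith_of_mem_FSSet (B : ConstSpeedBicombing X) {w : C(ℝ, X)}
    (hw : w ∈ FSSet B) : LipschitzWith 1 w := by
  refine closure_minimal ?_ isClosed_setOf_lipschitzWith_one hw
  rintro w ⟨x, y, τ, h⟩
  refine LipschitzWith.of_dist_le_mul fun s t => ?_
  rw [h, h]
  simpa using (lipschitzWith_trail B x y).dist_le_mul (s + τ) (t + τ)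

/-- The 1-Lipschitz maps `ℝ → X` with `w 0` in a fixed closed ball form a compact set. -/
lemma isCompact_lipschitzWith_one [ProperSpace X] (x : X) (C : ℝ) :
    IsCompact {w : C(ℝ, X) | LipschitzWith 1 w ∧ dist x (w 0) ≤ C} := by
  refine ArzelaAscoli.isCompact_of_equicontinuous _ ?_ ?_
  · have himage : ContinuousMap.toFun '' {w : C(ℝ, X) | LipschitzWith 1 w ∧ dist x (w 0) ≤ C} =
        {g : ℝ → X | LipschitzWith 1 g} ∩ {g : ℝ → X | dist x (g 0) ≤ C} := by
      ext g
      constructor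
      · rintro ⟨w, hw, rfl⟩
        exact hw
      · exact fun hg => ⟨⟨g, hg.1.continuous⟩, hg, rfl⟩
    rw [himage]
    refine (isCompact_univ_pi fun t : ℝ => isCompact_closedBall x (C + |t|)).of_isClosed_subset
      ((isClosed_setOfPred_lipschitzWith 1).inter (isClosed_le (by fun_prop) continuous_const)) ?_
    rintro g ⟨hg, h0⟩ t -
    have h1 : dist (g t) (g 0) ≤ |t| := by simpa using hg.dist_le_mul t 0
    rw [mem_ofPred_eq, dist_comm] at h0
    exact (dist_triangle _ _ _).trans (by linarith)
  · exact (LipschitzWith.uniformEquicontinuous _ 1 fun w => w.2.1).equicontinuous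

lemma integrable_comp_abs_of_integrableOn_Ioi {f : ℝ → ℝ} (hf : IntegrableOn f (Ioi 0)) :
    Integrable fun t => f |t| := by
  have hpos : IntegrableOn (fun t => f |t|) (Ioi 0) :=
    hf.congr_fun (fun t ht => by rw [abs_of_pos ht]) measurableSet_Ioi
  have hneg : IntegrableOn (fun t => f |t|) (Iic 0) := by
    have hemb : MeasurableEmbedding fun t : ℝ => -t := (Homeomorph.neg ℝ).measurableEmbedding
    rw [← Measure.map_neg_eq_self (volume : Measure ℝ), hemb.integrableOn_map_iff]
    simpa [Function.comp_def, integrableOn_Ici_iff_integrableOn_Ioi] using hpos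
  simpa [Iic_union_Ioi] using hneg.union hpos

lemma integrable_affine_abs_div_exp_abs (C : ℝ) :
    Integrable fun t : ℝ => (C + 2 * |t|) / (2 * Real.exp |t|) := by
  have h0 : IntegrableOn (fun t : ℝ => Real.exp (-t)) (Ioi 0) := by
    simpa using Real.GammaIntegral_convergent (s := 1) one_pos
  have h1 : IntegrableOn (fun t : ℝ => Real.exp (-t) * t) (Ioi 0) := by
    have h := Real.GammaIntegral_convergent (s := 2) two_pos
    norm_num at h
    exact h
  refine integrable_comp_abs_of_integrableOn_Ioi (f := fun t : ℝ => (C + 2 * t) / (2 * Real.exp t)) ?_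
  refine ((h0.const_mul (C / 2)).add h1).congr (Filter.Eventually.of_forall fun t => ?_)
  simp only [Pi.add_apply, Real.exp_neg]
  field_simp

lemma dist_le_dist_zero_add {f w : ℝ → X} (hf : LipschitzWith 1 f) (hw : LipschitzWith 1 w)
    (t : ℝ) : dist (f t) (w t) ≤ dist (f 0) (w 0) + 2 * |t| := by
  have h1 : dist (f t) (f 0) ≤ |t| := by simpa using hf.dist_le_mul t 0
  have h2 : dist (w 0) (w t) ≤ |t| := by simpa using hw.dist_le_mul 0 t
  linarith [dist_triangle4 (f t) (f 0) (w 0) (w t)]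

lemma norm_lipDist_integrand_le {f w : ℝ → X} (hf : LipschitzWith 1 f) (hw : LipschitzWith 1 w)
    {C : ℝ} (hC : dist (f 0) (w 0) ≤ C) (t : ℝ) :
    ‖dist (f t) (w t) / (2 * Real.exp |t|)‖ ≤ (C + 2 * |t|) / (2 * Real.exp |t|) := by
  rw [Real.norm_of_nonneg (by positivity)]
  gcongr
  linarith [dist_le_dist_zero_add hf hw t]

lemma continuous_lipDist_integrand {f w : ℝ → X} (hf : Continuous f) (hw : Continuous w) :
    Continuous fun t : ℝ => dist (f t) (w t) / (2 * Real.exp |t|) :=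
  (hf.dist hw).div (by fun_prop) fun t => by positivity

lemma dist_zero_le_of_lipDist_le {f w : ℝ → X} (hf : LipschitzWith 1 f) (hw : LipschitzWith 1 w)
    {R : ℝ} (h : lipDist f w ≤ R) : dist (f 0) (w 0) ≤ 2 * Real.exp 1 * R + 2 := by
  have hcont := continuous_lipDist_integrand hf.continuous hw.continuous
  have hint : Integrable fun t : ℝ => dist (f t) (w t) / (2 * Real.exp |t|) :=
    (integrable_affine_abs_div_exp_abs (dist (f 0) (w 0))).mono' hcont.aestronglyMeasurable
      (Filter.Eventually.of_forall (norm_lipDist_integrand_le hf hw le_rfl))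
  by_contra! hlt
  have hset : ∫ t in Icc (0 : ℝ) 1, dist (f t) (w t) / (2 * Real.exp |t|) ≤ R :=
    (setIntegral_le_integral hint (Filter.Eventually.of_forall fun t => by positivity)).trans h
  have hlow : (dist (f 0) (w 0) - 2) / (2 * Real.exp 1) * volume.real (Icc (0 : ℝ) 1) ≤
      ∫ t in Icc (0 : ℝ) 1, dist (f t) (w t) / (2 * Real.exp |t|) := by
    refine setIntegral_ge_of_const_le_real measurableSet_Icc (by simp) (fun t ht => ?_)
      hint.integrableOn
    have habs : |t| ≤ 1 := by rw [abs_of_nonneg ht.1]; exact ht.2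
    have hd : dist (f 0) (w 0) - 2 ≤ dist (f t) (w t) := by
      have h1 : dist (f 0) (f t) ≤ |t| := by simpa using hf.dist_le_mul 0 t
      have h2 : dist (w t) (w 0) ≤ |t| := by simpa using hw.dist_le_mul t 0
      linarith [dist_triangle4 (f 0) (f t) (w t) (w 0)]
    gcongr
  rw [Real.volume_real_Icc_of_le zero_le_one, sub_zero, mul_one] at hlow
  have := (div_le_iff₀ (by positivity)).1 (hlow.trans hset)
  linarith

lemma continuousOn_lipDist (f : C(ℝ, X)) (hf : LipschitzWith 1 f) (C : ℝ) :
    ContinuousOn (fun w : C(ℝ, X) => lipDist f w)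
      {w : C(ℝ, X) | LipschitzWith 1 w ∧ dist (f 0) (w 0) ≤ C} := by
  refine continuousOn_of_dominated
    (fun w _ => (continuous_lipDist_integrand f.continuous w.continuous).aestronglyMeasurable)
    (fun w hw => Filter.Eventually.of_forall (norm_lipDist_integrand_le hf hw.1 hw.2))
    (integrable_affine_abs_div_exp_abs C)
    (Filter.Eventually.of_forall fun t => Continuous.continuousOn ?_)
  exact (continuous_const.dist (continuous_eval_const t)).div_const _

end Auxiliary

/-- For a proper metric space `X` with a constant-speed bicombing `γ`, the flow space
`FS(X,γ)` with the restriction of the metric `D` is proper: every closed ball is compact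
(the topology on `FS(X,γ) ⊆ Lip₁(X)` being induced by `D`, equivalently by the
compact-open topology). -/
theorem fsset_properSpace {X : Type*} [MetricSpace X] [ProperSpace X]
    (B : ConstSpeedBicombing X) (f : C(ℝ, X)) (hf : f ∈ FSSet B) (R : ℝ) :
    IsCompact {w : {w : C(ℝ, X) // w ∈ FSSet B} | lipDist (⇑f) (⇑w.1) ≤ R} := by
  have hfL := lipschitzWith_of_mem_FSSet B hf
  have hK := isCompact_lipschitzWith_one (f 0) (2 * Real.exp 1 * R + 2)
  have hclosed := (continuousOn_lipDist f hfL _).preimage_isClosed_of_isClosed hK.isClosed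
    (isClosed_Iic (a := R))
  have hcompact := (hK.of_isClosed_subset hclosed inter_subset_left).inter_right
    (isClosed_closure (s := ASet B))
  rw [Subtype.isCompact_iff]
  convert hcompact using 1
  ext w
  constructor
  · rintro ⟨⟨w, hw⟩, hR, rfl⟩
    have hwL := lipschitzWith_of_mem_FSSet B hw
    exact ⟨⟨⟨hwL, dist_zero_le_of_lipDist_le hfL hwL hR⟩, hR⟩, hw⟩
  · rintro ⟨⟨-, hR⟩, hw⟩
    exact ⟨⟨w, hw⟩, hR, rfl⟩
end FJ
end

section
/- Let X be a metric space and γ a consistent constant-speed bicombing on X for which there is a continuous f : [0,∞) → [0,∞) with f(0) = 0 and |l(γ_{x,y}) − l(γ_{x',y'})| ≤ f(d(x,x') + d(y,y')) for all x,x',y,y'. Then FS(X,γ) equals the set of all w : ℝ → X such that for every finite interval [a,b] one has res_{[a,b]}(w) ∈ A(X,γ,[a,b]). Moreover every w ∈ FS(X,γ) is a trail: there exist w₋, w₊ ∈ [−∞,∞] such that w is a path of speed 1 on [w₋,w₊] and locally constant on the complement, and res_{[a,b]}(w) = Φ_{−max{a,w₋}} c_{w(a),w(b)}. -/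
open MeasureTheory Set

namespace FJ

open Filter Topology

lemma eVariationOn_comp_rescale {X : Type*} [PseudoEMetricSpace X] (g : ℝ → X) {p q : ℝ}
    (hpq : p < q) :
    eVariationOn (fun u => g ((u - p) / (q - p))) (Icc p q) = eVariationOn g (Icc 0 1) := by
  have hd : 0 < q - p := sub_pos.2 hpq
  have hmono : MonotoneOn (fun u : ℝ => (u - p) / (q - p)) (Icc p q) := by
    intro u _ v _ huv
    simp only
    gcongr
  have himage : (fun u : ℝ => (u - p) / (q - p)) '' Icc p q = Icc 0 1 := by
    ext r
    constructor
    · rintro ⟨u, hu, rfl⟩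
      exact ⟨div_nonneg (sub_nonneg.2 hu.1) hd.le, (div_le_one hd).2 (by linarith [hu.2])⟩
    · rintro ⟨h0, h1⟩
      refine ⟨p + r * (q - p), ⟨by nlinarith, by nlinarith⟩, ?_⟩
      simp only
      field_simp
      ring
  have h := eVariationOn.comp_eq_of_monotoneOn g _ hmono
  rwa [himage] at h

namespace ConstSpeedBicombing

variable {X : Type*} [MetricSpace X] (B : ConstSpeedBicombing X)

lemma eVariationOn_unit (x y : X) :
    eVariationOn (B.toFun x y) (Icc 0 1) = ENNReal.ofReal (B.len x y) := by
  simpa using B.speed x y 0 1 le_rfl zero_le_one le_rfl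

lemma eq_of_len_eq_zero {x y : X} (h : B.len x y = 0) : x = y := by
  have h1 := eVariationOn.edist_le (B.toFun x y) (s := Icc (0 : ℝ) 1) (x := 0) (y := 1)
    (by simp) (by simp)
  rw [B.eVariationOn_unit, h, B.source, B.target] at h1
  simpa using h1

/-- A modulus of continuity for the lengths of a bicombing makes `len` continuous. -/
lemma continuous_len {f : ℝ → ℝ} (hfc : ContinuousOn f (Ici 0)) (hf0 : f 0 = 0)
    (hlen : ∀ x x' y y' : X, |B.len x y - B.len x' y'| ≤ f (dist x x' + dist y y')) :
    Continuous fun p : X × X => B.len p.1 p.2 := by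
  rw [continuous_iff_continuousAt]
  intro p
  have hdist : Tendsto (fun q : X × X => dist q.1 p.1 + dist q.2 p.2) (𝓝 p) (𝓝[Ici 0] 0) := by
    refine tendsto_nhdsWithin_iff.2 ⟨?_, Eventually.of_forall fun q => ?_⟩
    · have : Continuous fun q : X × X => dist q.1 p.1 + dist q.2 p.2 := by fun_prop
      simpa using this.tendsto p
    · exact add_nonneg dist_nonneg dist_nonneg
  have hf : Tendsto f (𝓝[Ici 0] 0) (𝓝 0) := by
    simpa [hf0, ContinuousWithinAt] using hfc 0 (by simp)
  refine tendsto_iff_dist_tendsto_zero.2 (squeeze_zero (fun _ => dist_nonneg) (fun q => ?_)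
    (hf.comp hdist))
  exact hlen _ _ _ _

variable {B}

lemma len_sub_of_lt (hcons : BicombingConsistent B) (x y : X) {p q : ℝ} (hp : 0 ≤ p)
    (hpq : p < q) (hq : q ≤ 1) :
    B.len (B.toFun x y p) (B.toFun x y q) = B.len x y * (q - p) := by
  have h1 := B.speed x y p q hp hpq.le hq
  have h2 : eVariationOn (B.toFun x y) (Icc p q) =
      ENNReal.ofReal (B.len (B.toFun x y p) (B.toFun x y q)) := by
    rw [← B.eVariationOn_unit, ← eVariationOn_comp_rescale _ hpq]
    exact eVariationOn.eq_of_eqOn fun t ht => hcons x y p q t hp hpq hq ht.1 ht.2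
  rw [h2, ENNReal.ofReal_eq_ofReal_iff (B.len_nonneg _ _)
    (mul_nonneg (B.len_nonneg _ _) (sub_nonneg.2 hpq.le))] at h1
  exact h1

lemma len_self (hcons : BicombingConsistent B)
    (hcont : Continuous fun p : X × X => B.len p.1 p.2) (x : X) : B.len x x = 0 := by
  have hγ : ContinuousOn (B.toFun x x) (Icc 0 1) := by
    refine B.continuousOn.comp (f := fun t : ℝ => (x, x, t)) (by fun_prop) ?_
    intro t ht
    simpa using ht
  have hlim : Tendsto (fun t => B.len x (B.toFun x x t)) (𝓝[Ioc 0 1] 0) (𝓝 (B.len x x)) := by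
    have h0 : Tendsto (B.toFun x x) (𝓝[Ioc 0 1] 0) (𝓝 x) := by
      have := (hγ 0 (by simp)).mono Ioc_subset_Icc_self
      rwa [ContinuousWithinAt, B.source] at this
    exact (hcont.tendsto (x, x)).comp (tendsto_const_nhds.prodMk_nhds h0)
  have hlim' : Tendsto (fun t => B.len x (B.toFun x x t)) (𝓝[Ioc 0 1] 0) (𝓝 0) := by
    have h0 : Tendsto (fun t : ℝ => B.len x x * (t - 0)) (𝓝[Ioc 0 1] 0) (𝓝 0) := by
      have : Continuous fun t : ℝ => B.len x x * (t - 0) := by fun_prop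
      simpa using (this.tendsto 0).mono_left nhdsWithin_le_nhds
    refine h0.congr' ?_
    filter_upwards [self_mem_nhdsWithin] with t ht
    have := len_sub_of_lt hcons x x le_rfl ht.1 ht.2
    rw [B.source] at this
    exact this.symm
  have : (𝓝[Ioc (0 : ℝ) 1] 0).NeBot := by
    rw [← mem_closure_iff_nhdsWithin_neBot, closure_Ioc (by norm_num)]
    simp
  exact tendsto_nhds_unique hlim hlim'

lemma len_sub (hcons : BicombingConsistent B)
    (hcont : Continuous fun p : X × X => B.len p.1 p.2) (x y : X) {p q : ℝ} (hp : 0 ≤ p)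
    (hpq : p ≤ q) (hq : q ≤ 1) :
    B.len (B.toFun x y p) (B.toFun x y q) = B.len x y * (q - p) := by
  rcases hpq.eq_or_lt with rfl | h
  · simp [len_self hcons hcont]
  · exact len_sub_of_lt hcons x y hp h hq

end ConstSpeedBicombing

/-- The point of `[s, t]` nearest to the extended real `x`. -/
noncomputable def intervalProj (s t : ℝ) (x : EReal) : ℝ :=
  (max (s : EReal) (min (t : EReal) x)).toReal

lemma intervalProj_bot (s t : ℝ) : intervalProj s t ⊥ = s := by simp [intervalProj]

lemma intervalProj_top (s t : ℝ) : intervalProj s t ⊤ = max s t := by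
  simp only [intervalProj, min_top_right]
  rw [← EReal.coe_strictMono.monotone.map_max, EReal.toReal_coe]

lemma intervalProj_coe (s t x : ℝ) : intervalProj s t x = max s (min t x) := by
  simp only [intervalProj]
  rw [← EReal.coe_strictMono.monotone.map_min, ← EReal.coe_strictMono.monotone.map_max,
    EReal.toReal_coe]

lemma continuous_intervalProj (s t : ℝ) : Continuous (intervalProj s t) := by
  refine EReal.continuousOn_toReal.comp_continuous (by fun_prop) fun x => ?_
  have h1 : (max (s : EReal) (min (t : EReal) x)) ≠ ⊥ :=
    ((EReal.bot_lt_coe s).trans_le (le_max_left _ _)).ne'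
  have h2 : (max (s : EReal) (min (t : EReal) x)) ≠ ⊤ :=
    (max_lt (EReal.coe_lt_top s) ((min_le_left _ _).trans_lt (EReal.coe_lt_top t))).ne
  simp [h1, h2]

lemma intervalProj_add {s u t : ℝ} (hsu : s ≤ u) (hut : u ≤ t) (x : EReal) :
    intervalProj s t x = intervalProj s u x + intervalProj u t x - u := by
  induction x using EReal.rec with
  | bot => simp [intervalProj_bot]
  | top => simp [intervalProj_top, hsu, hut, hsu.trans hut]
  | coe x => simp only [intervalProj_coe]; grind

lemma intervalProj_mono (s t : ℝ) {x y : EReal} (hxy : x ≤ y) :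
    intervalProj s t x ≤ intervalProj s t y := by
  induction x using EReal.rec <;> induction y using EReal.rec <;>
    simp_all [intervalProj_bot, intervalProj_top, intervalProj_coe] <;> grind

lemma intervalProj_eq_left {s : ℝ} (t : ℝ) {x : EReal} (hx : x ≤ s) :
    intervalProj s t x = s := by
  induction x using EReal.rec <;>
    simp_all [intervalProj_bot, intervalProj_coe]

lemma intervalProj_eq_right {s t : ℝ} (hst : s ≤ t) {x : EReal} (hx : t ≤ x) :
    intervalProj s t x = t := by
  induction x using EReal.rec <;>
    simp_all [intervalProj_top, intervalProj_coe]

lemma clamp_sub_clamp_comm {s t x y : ℝ} (hst : s ≤ t) (hxy : x ≤ y) :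
    max s (min t y) - max s (min t x) = max x (min y t) - max x (min y s) := by
  rcases le_total s x with h1 | h1 <;> rcases le_total s y with h2 | h2 <;>
    rcases le_total t x with h3 | h3 <;> rcases le_total t y with h4 | h4 <;>
    simp [h1, h2, h3, h4, hst, hxy] <;> linarith

lemma clamp_sub_clamp_eq {a b s x y : ℝ} (hab : a ≤ b) (hxy : x ≤ y) :
    max a (min (max a (min b s)) y) - max a (min (max a (min b s)) x) =
      max 0 (min (max a (min b y) - max a (min b x)) (s - max a x)) := by
  rcases le_total s a with h1 | h1
  · rw [min_eq_right (h1.trans hab), max_eq_left h1]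
    grind
  rcases le_total s b with h2 | h2
  · rw [min_eq_right h2, max_eq_right h1]
    rcases le_total x a with h3 | h3 <;> rcases le_total y a with h4 | h4 <;>
      rcases le_total x s with h5 | h5 <;> rcases le_total y s with h6 | h6 <;>
      rcases le_total x b with h7 | h7 <;> rcases le_total y b with h8 | h8 <;>
      simp [h1, h2, h3, h4, h5, h6, h7, h8, hab, hxy] <;> grind
  · rw [min_eq_left h2, max_eq_right hab]
    grind

lemma clamp_sub_left_eq {a b s y : ℝ} (hab : a ≤ b) :
    max a (min (max a (min b s)) y) - a = max 0 (min (max a (min b y) - a) (s - a)) := by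
  rcases le_total s a with h1 | h1
  · rw [min_eq_right (h1.trans hab), max_eq_left h1]
    grind
  rcases le_total s b with h2 | h2
  · rw [min_eq_right h2, max_eq_right h1]
    grind
  · have h3 : max a (min b y) - a ≤ s - a :=
      sub_le_sub_right ((max_le hab (min_le_left b y)).trans h2) a
    rw [min_eq_left h2, max_eq_right hab, min_eq_left h3,
      max_eq_right (sub_nonneg.2 (le_max_left _ _))]

lemma right_sub_clamp_eq {a b s x : ℝ} (hab : a ≤ b) :
    max a (max a (min b s)) - max a (min (max a (min b s)) x) =
      max 0 (min (max a b - max a (min b x)) (s - max a x)) := by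
  rcases le_total s a with h1 | h1
  · rw [min_eq_right (h1.trans hab), max_eq_left h1]
    grind
  rcases le_total s b with h2 | h2
  · rw [min_eq_right h2, max_eq_right h1]
    grind
  · rw [min_eq_left h2, max_eq_right hab]
    grind

/-- The overlap of `[a, s]` with `[x, y]` in terms of that of `[a, b]` with `[x, y]`, where `m` is
the left end of the latter overlap. -/
lemma intervalProj_sub_eq_clamp {a b s m : ℝ} (hab : a ≤ b) {x y : EReal} (hxy : x ≤ y)
    (hm : x = ⊤ ∨ (m : EReal) = max (a : EReal) x) :
    intervalProj a (max a (min b s)) y - intervalProj a (max a (min b s)) x =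
      max 0 (min (intervalProj a b y - intervalProj a b x) (s - m)) := by
  induction x using EReal.rec with
  | top =>
    obtain rfl : y = ⊤ := top_le_iff.1 hxy
    simp
  | bot =>
    obtain rfl : m = a := by simpa using hm
    induction y using EReal.rec with
    | bot => simp [intervalProj_bot]
    | top => simp only [intervalProj_bot, intervalProj_top]; grind
    | coe y =>
      simp only [intervalProj_bot, intervalProj_coe]
      exact clamp_sub_left_eq hab
  | coe x =>
    obtain rfl : m = max a x := by
      rw [← EReal.coe_strictMono.monotone.map_max] at hm
      simpa using hm
    induction y using EReal.rec with
    | bot => simp at hxy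
    | top =>
      simp only [intervalProj_top, intervalProj_coe]
      exact right_sub_clamp_eq hab
    | coe y =>
      have hxy : x ≤ y := by simpa using hxy
      simp only [intervalProj_coe]
      exact clamp_sub_clamp_eq hab hxy

section Trails

variable {X : Type*} [MetricSpace X] {B : ConstSpeedBicombing X}

/-- `w` runs along the bicombing at unit speed between the times `wm` and `wp`, and rests outside
of that interval. -/
structure IsBicombingTrail (B : ConstSpeedBicombing X) (w : ℝ → X) (wm wp : EReal) : Prop where
  le : wm ≤ wp
  len_eq : ∀ s t : ℝ, s ≤ t → B.len (w s) (w t) = intervalProj s t wp - intervalProj s t wm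
  eq_toFun : ∀ s u t : ℝ, s ≤ u → u ≤ t → B.len (w s) (w t) ≠ 0 →
    w u = B.toFun (w s) (w t) (B.len (w s) (w u) / B.len (w s) (w t))

lemma trail_eq_toFun (x y : X) (t : ℝ) :
    trail B x y t = B.toFun x y (max 0 (min (B.len x y) t) / B.len x y) := by
  have h0 := B.len_nonneg x y
  unfold trail
  split_ifs with h1 h2
  · rw [min_eq_right (h1.trans h0), max_eq_left h1, zero_div, B.source]
  · rw [min_eq_right h2.le, max_eq_right (not_le.1 h1).le]
  · push Not at h1 h2
    rw [min_eq_left h2, max_eq_right h0]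
    rcases h0.eq_or_lt with h | h
    · rw [← h, div_zero, B.source, B.eq_of_len_eq_zero h.symm]
    · rw [div_self h.ne', B.target]

lemma isBicombingTrail_trail (hcons : BicombingConsistent B)
    (hcont : Continuous fun p : X × X => B.len p.1 p.2) (x y : X) (τ : ℝ) :
    IsBicombingTrail B (fun s => trail B x y (s + τ)) ((-τ : ℝ) : EReal)
      ((B.len x y - τ : ℝ) : EReal) := by
  have h0 := B.len_nonneg x y
  set L := B.len x y with hL
  set φ : ℝ → ℝ := fun s => max 0 (min L (s + τ)) with hφ
  have hφmono : Monotone φ := fun s t hst => by simp only [hφ]; gcongr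
  have hφ0 : ∀ s, 0 ≤ φ s := fun s => le_max_left _ _
  have hφL : ∀ s, φ s ≤ L := fun s => max_le h0 (min_le_left _ _)
  have htr : ∀ s, trail B x y (s + τ) = B.toFun x y (φ s / L) := fun s => trail_eq_toFun x y _
  have hlenφ : ∀ s t, s ≤ t →
      B.len (trail B x y (s + τ)) (trail B x y (t + τ)) = φ t - φ s := by
    intro s t hst
    rw [htr, htr, ConstSpeedBicombing.len_sub hcons hcont x y (div_nonneg (hφ0 s) h0)
      (div_le_div_of_nonneg_right (hφmono hst) h0) (div_le_one_of_le₀ (hφL t) h0), ← hL]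
    rcases h0.eq_or_lt with h | h
    · have h1 := hφL s
      have h2 := hφL t
      rw [← h] at h1 h2 ⊢
      linarith [hφ0 s, hφ0 t]
    · field_simp
  refine ⟨by exact_mod_cast by linarith, fun s t hst => ?_, fun s u t hsu hut hne => ?_⟩
  · rw [hlenφ s t hst, intervalProj_coe, intervalProj_coe,
      clamp_sub_clamp_comm hst (by linarith : -τ ≤ L - τ)]
    have hφ' : ∀ r, φ r = max (-τ) (min (L - τ) r) + τ := fun r => by
      rw [max_add, min_add]
      simp [hφ]
    rw [hφ', hφ', add_sub_add_right_eq_sub]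
  · rw [hlenφ s t (hsu.trans hut)] at hne ⊢
    rw [hlenφ s u hsu]
    have hst : φ s < φ t :=
      lt_of_le_of_ne (hφmono (hsu.trans hut)) fun h => hne (by rw [h, sub_self])
    have hLpos : 0 < L := (hφ0 s).trans_lt (hst.trans_le (hφL t))
    rw [htr, htr, htr, hcons x y (φ s / L) (φ t / L) (φ u / L) (div_nonneg (hφ0 s) h0)
      (div_lt_div_of_pos_right hst hLpos) (div_le_one_of_le₀ (hφL t) h0)
      (div_le_div_of_nonneg_right (hφmono hsu) h0) (div_le_div_of_nonneg_right (hφmono hut) h0)]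
    congr 1
    rw [← sub_div, ← sub_div, div_div_div_cancel_right₀ hLpos.ne']

namespace IsBicombingTrail

variable {w : ℝ → X} {wm wp : EReal}

lemma len_le (h : IsBicombingTrail B w wm wp) {s u t : ℝ} (hsu : s ≤ u) (hut : u ≤ t) :
    B.len (w s) (w u) ≤ B.len (w s) (w t) := by
  rw [h.len_eq s u hsu, h.len_eq s t (hsu.trans hut), intervalProj_add hsu hut wp,
    intervalProj_add hsu hut wm]
  linarith [intervalProj_mono u t h.le]

lemma eq_toFun' (h : IsBicombingTrail B w wm wp) {s u t : ℝ} (hsu : s ≤ u) (hut : u ≤ t) :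
    w u = B.toFun (w s) (w t) (B.len (w s) (w u) / B.len (w s) (w t)) := by
  by_cases h0 : B.len (w s) (w t) = 0
  · have hle := h.len_le hsu hut
    rw [h0] at hle
    rw [h0, div_zero, B.source]
    exact (B.eq_of_len_eq_zero (hle.antisymm (B.len_nonneg _ _))).symm
  · exact h.eq_toFun s u t hsu hut h0

lemma eVariationOn_eq (h : IsBicombingTrail B w wm wp) {s t : ℝ} (hs : wm ≤ s) (hst : s ≤ t)
    (ht : t ≤ wp) : eVariationOn w (Icc s t) = ENNReal.ofReal (t - s) := by
  rcases hst.eq_or_lt with rfl | hlt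
  · simp [eVariationOn.subsingleton]
  have hl : ∀ u, s ≤ u → u ≤ t → B.len (w s) (w u) = u - s := by
    intro u hsu hut
    rw [h.len_eq s u hsu, intervalProj_eq_left u hs,
      intervalProj_eq_right hsu ((EReal.coe_le_coe_iff.2 hut).trans ht)]
  calc eVariationOn w (Icc s t)
      = eVariationOn (fun u => B.toFun (w s) (w t) ((u - s) / (t - s))) (Icc s t) := by
        refine eVariationOn.eq_of_eqOn fun u hu => ?_
        rw [h.eq_toFun' hu.1 hu.2, hl u hu.1 hu.2, hl t hst le_rfl]
    _ = ENNReal.ofReal (t - s) := by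
        rw [eVariationOn_comp_rescale _ hlt, B.eVariationOn_unit, hl t hst le_rfl]

lemma eq_of_le_left (h : IsBicombingTrail B w wm wp) {s t : ℝ} (hst : s ≤ t) (ht : t ≤ wm) :
    w s = w t := by
  refine B.eq_of_len_eq_zero ?_
  rw [h.len_eq s t hst, intervalProj_eq_right hst ht, intervalProj_eq_right hst (ht.trans h.le),
    sub_self]

lemma eq_of_right_le (h : IsBicombingTrail B w wm wp) {s t : ℝ} (hs : wp ≤ s) (hst : s ≤ t) :
    w s = w t := by
  refine B.eq_of_len_eq_zero ?_
  rw [h.len_eq s t hst, intervalProj_eq_left t hs, intervalProj_eq_left t (h.le.trans hs),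
    sub_self]

end IsBicombingTrail

lemma trailRes_eq_clamp {X : Type*} {a b : ℝ} (hab : a ≤ b) (w : ℝ → X) (s : ℝ) :
    trailRes a b w s = w (max a (min b s)) := by
  unfold trailRes
  split_ifs with h1 h2
  · rw [min_eq_right (h1.trans hab), max_eq_left h1]
  · rw [min_eq_right h2, max_eq_right (not_le.1 h1).le]
  · rw [min_eq_left (not_le.1 h2).le, max_eq_right hab]

lemma IsBicombingTrail.trailRes_eq {w : ℝ → X} {wm wp : EReal} (h : IsBicombingTrail B w wm wp)
    {a b m : ℝ} (hab : a ≤ b) (hm : wm = ⊤ ∨ (m : EReal) = max (a : EReal) wm) (s : ℝ) :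
    trailRes a b w s = trail B (w a) (w b) (s - m) := by
  rw [trailRes_eq_clamp hab, trail_eq_toFun,
    h.eq_toFun' (le_max_left a (min b s)) (max_le hab (min_le_left b s)),
    h.len_eq _ _ (le_max_left a (min b s)), h.len_eq a b hab,
    intervalProj_sub_eq_clamp hab h.le hm]

lemma exists_isBicombingTrail_of_mem_FSSet (hcons : BicombingConsistent B)
    (hcont : Continuous fun p : X × X => B.len p.1 p.2) {w : C(ℝ, X)} (hw : w ∈ FSSet B) :
    ∃ wm wp : EReal, IsBicombingTrail B w wm wp := by
  have hA : ∀ v : C(ℝ, X), v ∈ ASet B → ∃ p : EReal × EReal, IsBicombingTrail B v p.1 p.2 := by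
    rintro v ⟨x, y, τ, hv⟩
    refine ⟨((-τ : ℝ), (B.len x y - τ : ℝ)), ?_⟩
    rw [show ⇑v = fun s => trail B x y (s + τ) from funext hv]
    exact isBicombingTrail_trail hcons hcont x y τ
  choose! e he using hA
  obtain ⟨U, hAU, hUw⟩ := mem_closure_iff_ultrafilter.1 hw
  obtain ⟨⟨wm, wp⟩, -, hp⟩ := isCompact_univ.ultrafilter_le_nhds (U.map e) (by simp)
  have hp : Tendsto e U (𝓝 (wm, wp)) := hp
  have hm : Tendsto (fun v => (e v).1) U (𝓝 wm) := (continuous_fst.tendsto _).comp hp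
  have hp : Tendsto (fun v => (e v).2) U (𝓝 wp) := (continuous_snd.tendsto _).comp hp
  have hev : ∀ᶠ v : C(ℝ, X) in U, IsBicombingTrail B v (e v).1 (e v).2 :=
    mem_of_superset hAU he
  have hpt : ∀ s, Tendsto (fun v : C(ℝ, X) => v s) U (𝓝 (w s)) := fun s =>
    ((continuous_eval_const s).tendsto w).mono_left hUw
  have hlen : ∀ s t, Tendsto (fun v : C(ℝ, X) => B.len (v s) (v t)) U
      (𝓝 (B.len (w s) (w t))) := fun s t =>
    (hcont.tendsto (w s, w t)).comp ((hpt s).prodMk_nhds (hpt t))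
  refine ⟨wm, wp, le_of_tendsto_of_tendsto hm hp (hev.mono fun v hv => hv.le),
    fun s t hst => ?_, fun s u t hsu hut hne => ?_⟩
  · refine tendsto_nhds_unique (hlen s t) ?_
    refine ((((continuous_intervalProj s t).tendsto wp).comp hp).sub
      (((continuous_intervalProj s t).tendsto wm).comp hm)).congr' ?_
    exact hev.mono fun v hv => (hv.len_eq s t hst).symm
  · have hratio : ∀ᶠ v : C(ℝ, X) in U,
        (v s, v t, B.len (v s) (v u) / B.len (v s) (v t)) ∈
          (univ ×ˢ univ ×ˢ Icc (0 : ℝ) 1 : Set (X × X × ℝ)) := by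
      filter_upwards [hev] with v hv
      exact ⟨mem_univ _, mem_univ _, div_nonneg (B.len_nonneg _ _) (B.len_nonneg _ _),
        div_le_one_of_le₀ (hv.len_le hsu hut) (B.len_nonneg _ _)⟩
    have hlim := (hpt s).prodMk_nhds ((hpt t).prodMk_nhds ((hlen s u).div (hlen s t) hne))
    have hmem : (w s, w t, B.len (w s) (w u) / B.len (w s) (w t)) ∈
        (univ ×ˢ univ ×ˢ Icc (0 : ℝ) 1 : Set (X × X × ℝ)) :=
      (isClosed_univ.prod (isClosed_univ.prod isClosed_Icc)).mem_of_tendsto hlim hratio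
    refine tendsto_nhds_unique (hpt u) (Tendsto.congr' ?_ ((B.continuousOn _ hmem).tendsto.comp
      (tendsto_nhdsWithin_iff.2 ⟨hlim, hratio⟩)))
    filter_upwards [hev] with v hv
    exact (hv.eq_toFun' hsu hut).symm

lemma exists_mem_AIntSet {w : C(ℝ, X)} {wm wp : EReal} (h : IsBicombingTrail B w wm wp) {a b : ℝ}
    (hab : a ≤ b) : ∃ v ∈ AIntSet B a b, ∀ s, v s = trailRes a b w s := by
  obtain ⟨m, hm⟩ : ∃ m : ℝ, wm = ⊤ ∨ (m : EReal) = max (a : EReal) wm := by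
    induction wm using EReal.rec with
    | bot => exact ⟨a, by simp⟩
    | top => exact ⟨a, Or.inl rfl⟩
    | coe x => exact ⟨max a x, Or.inr (EReal.coe_strictMono.monotone.map_max)⟩
  refine ⟨⟨fun s => w (max a (min b s)), by fun_prop⟩, ⟨⟨w a, w b, -m, fun s => ?_⟩,
    fun s hs => ?_, fun s hs => ?_⟩, fun s => (trailRes_eq_clamp hab w s).symm⟩
  · rw [← sub_eq_add_neg, ← h.trailRes_eq hab hm, trailRes_eq_clamp hab, ContinuousMap.coe_mk]
  · simp [hs, hab, hs.trans hab]
  · simp [hs]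

lemma exists_mem_FSSet_of_trailRes {w : ℝ → X}
    (hw : ∀ a b : ℝ, a ≤ b → ∃ v ∈ AIntSet B a b, ∀ s, v s = trailRes a b w s) :
    ∃ wc : C(ℝ, X), ⇑wc = w ∧ wc ∈ FSSet B := by
  have hn : ∀ n : ℕ, ∃ v ∈ ASet B, EqOn v w (Icc (-n : ℝ) n) := by
    intro n
    have hle : (-n : ℝ) ≤ n := neg_le_self n.cast_nonneg
    obtain ⟨v, hv, hvw⟩ := hw (-n) n hle
    refine ⟨v, hv.1, fun s hs => ?_⟩
    rw [hvw, trailRes_eq_clamp hle, min_eq_right hs.2, max_eq_right hs.1]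
  choose v hvA hvw using hn
  have hcont : Continuous w := by
    rw [continuous_iff_continuousAt]
    intro t
    obtain ⟨n, hn⟩ := exists_nat_gt |t|
    rw [abs_lt] at hn
    exact (v n).continuous.continuousAt.congr
      ((hvw n).eventuallyEq_of_mem (Icc_mem_nhds hn.1 hn.2))
  refine ⟨⟨w, hcont⟩, rfl, mem_closure_of_tendsto (f := v) (b := atTop) ?_
    (Eventually.of_forall hvA)⟩
  rw [ContinuousMap.tendsto_iff_forall_isCompact_tendstoUniformlyOn]
  intro K hK
  obtain ⟨R, hR⟩ := hK.isBounded.subset_closedBall 0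
  obtain ⟨N, hN⟩ := exists_nat_ge R
  intro V hV
  filter_upwards [eventually_ge_atTop N] with n hNn s hs
  have hsR : |s| ≤ n := by
    have h1 : |s| ≤ R := by simpa using hR hs
    exact h1.trans (hN.trans (by exact_mod_cast hNn))
  rw [hvw n (abs_le.1 hsR)]
  exact refl_mem_uniformity hV

end Trails

/-- For a consistent bicombing (with length control function `f`): `FS(X,γ)` equals the
set of all `w : ℝ → X` such that `res_{[a,b]}(w) ∈ A(X,γ,[a,b])` for every finite
interval `[a,b]`. Moreover, every `w ∈ FS(X,γ)` is a trail: there are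
`w₋, w₊ ∈ [−∞,∞]` such that `w` has speed `1` on `[w₋,w₊]` and is locally constant on
the complement, and `res_{[a,b]}(w) = Φ_{−max{a,w₋}} c_{w(a),w(b)}`. -/
theorem fsset_eq_trails {X : Type*} [MetricSpace X] (B : ConstSpeedBicombing X)
    (hcons : BicombingConsistent B)
    (f : ℝ → ℝ) (hfc : ContinuousOn f (Set.Ici 0)) (hf0 : f 0 = 0)
    (hfnn : ∀ s, 0 ≤ s → 0 ≤ f s)
    (hlen : ∀ x x' y y' : X, |B.len x y - B.len x' y'| ≤ f (dist x x' + dist y y')) :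
    ({w : ℝ → X | ∃ wc : C(ℝ, X), ⇑wc = w ∧ wc ∈ FSSet B} =
      {w : ℝ → X | ∀ a b : ℝ, a ≤ b →
        ∃ v ∈ AIntSet B a b, ∀ s, v s = trailRes a b w s}) ∧
    ∀ w : C(ℝ, X), w ∈ FSSet B →
      ∃ wm wp : EReal, wm ≤ wp ∧
        (∀ s t : ℝ, wm ≤ (s : EReal) → s ≤ t → (t : EReal) ≤ wp →
          eVariationOn (⇑w) (Set.Icc s t) = ENNReal.ofReal (t - s)) ∧
        (∀ s t : ℝ, s ≤ t → (t : EReal) ≤ wm → w s = w t) ∧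
        (∀ s t : ℝ, wp ≤ (s : EReal) → s ≤ t → w s = w t) ∧
        ∀ a b : ℝ, a ≤ b → ∀ m : ℝ, (m : EReal) = max (a : EReal) wm →
          ∀ s : ℝ, trailRes a b (⇑w) s = trail B (w a) (w b) (s - m) := by
  have hcont := B.continuous_len hfc hf0 hlen
  refine ⟨Subset.antisymm ?_ fun w hw => exists_mem_FSSet_of_trailRes hw, fun w hw => ?_⟩
  · rintro _ ⟨w, rfl, hw⟩ a b hab
    obtain ⟨wm, wp, h⟩ := exists_isBicombingTrail_of_mem_FSSet hcons hcont hw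
    exact exists_mem_AIntSet h hab
  · obtain ⟨wm, wp, h⟩ := exists_isBicombingTrail_of_mem_FSSet hcons hcont hw
    exact ⟨wm, wp, h.le, fun s t hs hst ht => h.eVariationOn_eq hs hst ht,
      fun s t hst ht => h.eq_of_le_left hst ht, fun s t hs hst => h.eq_of_right_le hs hst,
      fun a b hab m hm s => h.trailRes_eq hab (Or.inr hm) s⟩

end FJ
end
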